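/- For D > 2 and every t ≥ 0 such that (D−2) x̄ γ̃(t) < 2 D γ₂² α^D, the gradient-flow trajectory satisfies ‖w(t)‖₂ ≤ (x_max/(2γ₂²)) · [ (2γ₂²α^D/x̄) · h_D( ((D−2)x̄/(2Dγ₂²α^D)) γ̃(t) ) − 2γ̃(t) ] + 2D²α^{2D−2} ∫₀ᵗ ‖X r(τ)‖₂ dτ. -/

import Mathlib

open Real Finset Filter Topology MeasureTheory

/-- A function continuous on `[0, ∞)` has a primitive there, given by the interval integral. -/
lemma exists_primitive_Ici {f : ℝ → ℝ} (hf : ContinuousOn f (Set.Ici 0)) :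
    ∃ F : ℝ → ℝ, (∀ t, 0 ≤ t → F t = ∫ s in (0:ℝ)..t, f s) ∧
      ∀ t, 0 ≤ t → HasDerivAt F (f t) t := by
  have hc : Continuous fun s => f (max s 0) :=
    hf.comp_continuous (continuous_id.max continuous_const) fun s => Set.mem_Ici.2 (le_max_right s 0)
  refine ⟨fun t => ∫ s in (0:ℝ)..t, f (max s 0), fun t ht => ?_, fun t ht => ?_⟩
  · refine intervalIntegral.integral_congr fun s hs => ?_
    rw [Set.uIcc_of_le ht] at hs
    simp [max_eq_left hs.1]
  · simpa [max_eq_left ht] using hc.integral_hasStrictDerivAt 0 t |>.hasDerivAt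

lemma apply_zero_le_of_hasDerivAt_nonneg {f f' : ℝ → ℝ}
    (hf : ∀ t, 0 ≤ t → HasDerivAt f (f' t) t) (hf' : ∀ t, 0 ≤ t → 0 ≤ f' t) {t : ℝ}
    (ht : 0 ≤ t) : f 0 ≤ f t := by
  have hmono : MonotoneOn f (Set.Ici 0) := by
    refine monotoneOn_of_hasDerivWithinAt_nonneg (f' := f') (convex_Ici 0)
      (fun s hs => (hf s hs).continuousAt.continuousWithinAt) (fun s hs => ?_) fun s hs => ?_
    · rw [interior_Ici] at hs ⊢
      exact (hf s (le_of_lt hs)).hasDerivWithinAt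
    · rw [interior_Ici] at hs
      exact hf' s (le_of_lt hs)
  exact hmono Set.self_mem_Ici ht ht

lemma apply_eq_apply_zero_of_hasDerivAt_zero {f : ℝ → ℝ}
    (hf : ∀ t, 0 ≤ t → HasDerivAt f 0 t) {t : ℝ} (ht : 0 ≤ t) : f t = f 0 := by
  refine le_antisymm ?_ (apply_zero_le_of_hasDerivAt_nonneg hf (fun _ _ => le_rfl) ht)
  have := apply_zero_le_of_hasDerivAt_nonneg (f := fun s => -f s) (f' := fun _ => 0)
    (fun s hs => (hf s hs).neg.congr_deriv neg_zero) (fun _ _ => le_rfl) ht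
  linarith

/-- Solutions of a scalar linear ODE with positive initial value stay positive. -/
lemma pos_of_hasDerivAt_mul {u c : ℝ → ℝ} (hc : ContinuousOn c (Set.Ici 0))
    (hu : ∀ t, 0 ≤ t → HasDerivAt u (c t * u t) t) (h0 : 0 < u 0) {t : ℝ} (ht : 0 ≤ t) :
    0 < u t := by
  obtain ⟨C, -, hC⟩ := exists_primitive_Ici hc
  have key := apply_eq_apply_zero_of_hasDerivAt_zero (f := fun s => u s * exp (-C s))
    (fun s hs => by
      refine ((hu s hs).mul (hC s hs).neg.exp).congr_deriv ?_
      simp only [Pi.neg_apply]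
      ring) ht
  have : 0 < u t * exp (-C t) := by
    rw [key]
    positivity
  exact pos_of_mul_pos_left this (exp_pos _).le

/-- Explicit solution of `u' = (m + 2) * u ^ (m + 1) * a` for a positive initial value. -/
lemma pos_and_inv_pow_of_hasDerivAt {m : ℕ} {u a A : ℝ → ℝ} (ha : ContinuousOn a (Set.Ici 0))
    (hA : ∀ t, 0 ≤ t → HasDerivAt A (a t) t) (hA0 : A 0 = 0)
    (hu : ∀ t, 0 ≤ t → HasDerivAt u ((m + 2) * u t ^ (m + 1) * a t) t) (h0 : 0 < u 0) {t : ℝ}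
    (ht : 0 ≤ t) :
    0 < u t ∧ (u t ^ m)⁻¹ = (u 0 ^ m)⁻¹ - (m + 2) * m * A t := by
  have hcu : ContinuousOn u (Set.Ici 0) := fun s hs => (hu s hs).continuousAt.continuousWithinAt
  have hpos : ∀ s, 0 ≤ s → 0 < u s := fun s hs =>
    pos_of_hasDerivAt_mul (c := fun s => (m + 2) * u s ^ m * a s)
      ((continuousOn_const.mul (hcu.pow m)).mul ha)
      (fun r hr => (hu r hr).congr_deriv (by ring)) h0 hs
  refine ⟨hpos t ht, ?_⟩
  have key := apply_eq_apply_zero_of_hasDerivAt_zero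
    (f := fun s => (u s ^ m)⁻¹ + (m + 2) * m * A s) (fun s hs => by
      have hs0 := (hpos s hs).ne'
      refine ((((hu s hs).pow m).inv (pow_ne_zero m hs0)).add
        ((hA s hs).const_mul ((m + 2) * m : ℝ))).congr_deriv ?_
      rcases m with _ | m
      · simp
      · simp only [Pi.pow_apply, Nat.add_sub_cancel]
        field_simp
        ring) ht
  simp only [hA0] at key
  linarith

lemma hasDerivAt_one_sub_rpow_neg (q : ℝ) {s : ℝ} (hs : s < 1) :
    HasDerivAt (fun s : ℝ => (1 - s) ^ (-q)) (q * (1 - s) ^ (-(q + 1))) s := by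
  have := ((hasDerivAt_id s).const_sub 1).rpow_const (p := -q) (Or.inl (by simp; linarith))
  refine this.congr_deriv ?_
  simp only [id_eq]
  rw [show -q - 1 = -(q + 1) by ring]
  ring

lemma hasDerivAt_one_add_rpow_neg (q : ℝ) {s : ℝ} (hs : -1 < s) :
    HasDerivAt (fun s : ℝ => (1 + s) ^ (-q)) (-(q * (1 + s) ^ (-(q + 1)))) s := by
  have := ((hasDerivAt_id s).const_add 1).rpow_const (p := -q) (Or.inl (by simp; linarith))
  refine this.congr_deriv ?_
  simp only [id_eq]
  rw [show -q - 1 = -(q + 1) by ring]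
  ring

/-- The part of `(1 - s) ^ (-p) - (1 + s) ^ (-p)` that is superlinear at `0`. -/
noncomputable def superlinearPart (p s : ℝ) : ℝ := (1 - s) ^ (-p) - (1 + s) ^ (-p) - 2 * p * s

lemma superlinearPart_zero (p : ℝ) : superlinearPart p 0 = 0 := by simp [superlinearPart]

lemma superlinearPart_neg (p s : ℝ) : superlinearPart p (-s) = -superlinearPart p s := by
  simp only [superlinearPart, sub_neg_eq_add, ← sub_eq_add_neg]
  ring

lemma superlinearPart_nonneg_convexOn {p : ℝ} (hp : 0 < p) :
    (∀ s ∈ Set.Ico (0:ℝ) 1, 0 ≤ superlinearPart p s) ∧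
      ConvexOn ℝ (Set.Ico 0 1) (superlinearPart p) := by
  have hd2 : ∀ s ∈ Set.Ico (0:ℝ) 1, HasDerivAt
      (fun s : ℝ => p * (1 - s) ^ (-(p + 1)) + p * (1 + s) ^ (-(p + 1)) - 2 * p)
      (p * ((p + 1) * (1 - s) ^ (-(p + 1 + 1))) - p * ((p + 1) * (1 + s) ^ (-(p + 1 + 1)))) s := by
    intro s hs
    refine ((((hasDerivAt_one_sub_rpow_neg (p + 1) hs.2).const_mul p).add
      ((hasDerivAt_one_add_rpow_neg (p + 1) (by linarith [hs.1])).const_mul p)).sub_const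
      (2 * p)).congr_deriv ?_
    ring
  have hd1 : ∀ s ∈ Set.Ico (0:ℝ) 1, HasDerivAt (superlinearPart p)
      (p * (1 - s) ^ (-(p + 1)) + p * (1 + s) ^ (-(p + 1)) - 2 * p) s := by
    intro s hs
    refine (((hasDerivAt_one_sub_rpow_neg p hs.2).sub
      (hasDerivAt_one_add_rpow_neg p (by linarith [hs.1]))).sub
      ((hasDerivAt_id s).const_mul (2 * p))).congr_deriv ?_
    ring
  have hmono2 : MonotoneOn (fun s : ℝ => p * (1 - s) ^ (-(p + 1)) + p * (1 + s) ^ (-(p + 1)) - 2 * p)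
      (Set.Ico 0 1) := by
    refine monotoneOn_of_hasDerivWithinAt_nonneg (convex_Ico 0 1)
      (fun s hs => (hd2 s hs).continuousAt.continuousWithinAt)
      (fun s hs => (hd2 s (interior_subset hs)).hasDerivWithinAt) fun s hs => ?_
    have hs' := interior_subset hs
    have : (1 + s) ^ (-(p + 1 + 1)) ≤ (1 - s) ^ (-(p + 1 + 1)) :=
      rpow_le_rpow_of_nonpos (by linarith [hs'.2]) (by linarith [hs'.1]) (by linarith)
    have h1 : 0 ≤ p * (p + 1) := by positivity
    nlinarith [mul_le_mul_of_nonneg_left this h1]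
  have hnonneg : ∀ s ∈ Set.Ico (0:ℝ) 1,
      0 ≤ p * (1 - s) ^ (-(p + 1)) + p * (1 + s) ^ (-(p + 1)) - 2 * p := by
    intro s hs
    have := hmono2 (Set.left_mem_Ico.2 one_pos) hs hs.1
    simp only [sub_zero, add_zero, one_rpow] at this
    linarith
  have hcont : ContinuousOn (superlinearPart p) (Set.Ico 0 1) :=
    fun s hs => (hd1 s hs).continuousAt.continuousWithinAt
  refine ⟨fun s hs => ?_, ?_⟩
  · have hmono : MonotoneOn (superlinearPart p) (Set.Ico 0 1) :=
      monotoneOn_of_hasDerivWithinAt_nonneg (convex_Ico 0 1) hcont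
        (fun s hs => (hd1 s (interior_subset hs)).hasDerivWithinAt)
        fun s hs => hnonneg s (interior_subset hs)
    simpa [superlinearPart_zero] using hmono (Set.left_mem_Ico.2 one_pos) hs hs.1
  · refine MonotoneOn.convexOn_of_deriv (convex_Ico 0 1) hcont
      (fun s hs => (hd1 s (interior_subset hs)).differentiableAt.differentiableWithinAt) ?_
    exact (hmono2.mono interior_subset).congr fun s hs => (hd1 s (interior_subset hs)).deriv.symm

lemma abs_superlinearPart_le {p s z : ℝ} (hp : 0 < p) (hsz : |s| ≤ z) (hz : z < 1) :
    |superlinearPart p s| ≤ superlinearPart p z / z * |s| := by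
  obtain ⟨hnn, hconv⟩ := superlinearPart_nonneg_convexOn hp
  have habs : |superlinearPart p s| = superlinearPart p |s| := by
    have h := hnn |s| ⟨abs_nonneg s, hsz.trans_lt hz⟩
    rcases abs_cases s with ⟨h1, -⟩ | ⟨h1, -⟩ <;> rw [h1] at h ⊢
    · exact abs_of_nonneg h
    · rw [superlinearPart_neg] at h ⊢
      exact abs_of_nonpos (by linarith)
  rw [habs]
  rcases (abs_nonneg s).trans hsz |>.eq_or_lt with hz0 | hz0
  · have : |s| = 0 := le_antisymm (hz0 ▸ hsz) (abs_nonneg s)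
    simp [this, superlinearPart_zero]
  · have h := hconv.2 (Set.left_mem_Ico.2 one_pos) (⟨hz0.le, hz⟩ : z ∈ Set.Ico (0:ℝ) 1)
      (sub_nonneg.2 ((div_le_one hz0).2 hsz)) (div_nonneg (abs_nonneg s) hz0.le) (by ring)
    simp only [smul_eq_mul, mul_zero, zero_add, superlinearPart_zero] at h
    rw [div_mul_cancel₀ _ hz0.ne'] at h
    calc _ ≤ _ := h
      _ = _ := by ring

lemma sqrt_sum_sq_le_of_dual {ι : Type*} [Fintype ι] {a : ι → ℝ} {B : ℝ} (hB : 0 ≤ B)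
    (h : ∑ i, a i ^ 2 ≤ B * √(∑ i, a i ^ 2)) : √(∑ i, a i ^ 2) ≤ B := by
  rcases (sqrt_nonneg (∑ i, a i ^ 2)).eq_or_lt with h0 | h0
  · rw [← h0]; exact hB
  · refine le_of_mul_le_mul_right ?_ h0
    rwa [mul_self_sqrt (sum_nonneg fun i _ => sq_nonneg (a i))]

lemma sqrt_sum_sq_sum_mul_le {ι κ : Type*} [Fintype ι] [Fintype κ] {r : κ → ℝ} {x : κ → ι → ℝ}
    {M : ℝ} (hr : ∀ n, 0 ≤ r n) (hM : ∀ n, √(∑ i, x n i ^ 2) ≤ M) :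
    √(∑ i, (∑ n, r n * x n i) ^ 2) ≤ M * ∑ n, r n := by
  have hB : 0 ≤ M * ∑ n, r n := by
    rw [mul_sum]
    exact sum_nonneg fun n _ => mul_nonneg ((sqrt_nonneg _).trans (hM n)) (hr n)
  refine sqrt_sum_sq_le_of_dual hB ?_
  set a : ι → ℝ := fun i => ∑ n, r n * x n i
  calc ∑ i, a i ^ 2 = ∑ n, r n * ∑ i, x n i * a i := by
        simp_rw [mul_sum]
        rw [sum_comm]
        refine sum_congr rfl fun i _ => ?_
        rw [sq]
        nth_rewrite 1 [show a i = ∑ n, r n * x n i from rfl]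
        rw [sum_mul]
        exact sum_congr rfl fun n _ => by ring
    _ ≤ ∑ n, r n * (M * √(∑ i, a i ^ 2)) := by
        refine sum_le_sum fun n _ => mul_le_mul_of_nonneg_left ?_ (hr n)
        exact (sum_mul_le_sqrt_mul_sqrt univ (x n) a).trans
          (mul_le_mul_of_nonneg_right (hM n) (sqrt_nonneg _))
    _ = _ := by rw [← sum_mul]; ring

lemma sqrt_sum_sq_le_of_hasDerivAt {ι : Type*} [Fintype ι] {G a : ι → ℝ → ℝ} {F f : ℝ → ℝ}
    (hG : ∀ i s, 0 ≤ s → HasDerivAt (G i) (a i s) s) (hG0 : ∀ i, G i 0 = 0)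
    (hF : ∀ s, 0 ≤ s → HasDerivAt F (f s) s) (hF0 : F 0 = 0)
    (haf : ∀ s, 0 ≤ s → √(∑ i, a i s ^ 2) ≤ f s) {t : ℝ} (ht : 0 ≤ t) :
    √(∑ i, G i t ^ 2) ≤ F t := by
  have hFt : 0 ≤ F t := hF0 ▸ apply_zero_le_of_hasDerivAt_nonneg hF
    (fun s hs => (sqrt_nonneg _).trans (haf s hs)) ht
  refine sqrt_sum_sq_le_of_dual hFt ?_
  have key := apply_zero_le_of_hasDerivAt_nonneg
    (f := fun s => F s * √(∑ i, G i t ^ 2) - ∑ i, G i t * G i s)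
    (fun s hs => ((hF s hs).mul_const _).sub
      (HasDerivAt.fun_sum fun i _ => (hG i s hs).const_mul (G i t))) (fun s hs => by
      have h1 := sum_mul_le_sqrt_mul_sqrt univ (fun i => G i t) (fun i => a i s)
      have h2 := mul_le_mul_of_nonneg_right (haf s hs) (sqrt_nonneg (∑ i, G i t ^ 2))
      linarith) ht
  simp only [hF0, hG0, zero_mul, mul_zero, sum_const_zero, sub_zero] at key
  simp_rw [sq] at key ⊢
  linarith

lemma two_mul_pow_le_of_inv_pow {m : ℕ} (hm : m ≠ 0) {α u v q : ℝ} (hα : 0 < α) (hu : 0 < u)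
    (hv : 0 < v) (h1 : (u ^ m)⁻¹ = (α ^ m)⁻¹ - q) (h2 : (v ^ m)⁻¹ = (α ^ m)⁻¹ + q) :
    2 * α ^ (2 * m + 2) ≤ u ^ (2 * m + 2) + v ^ (2 * m + 2) := by
  have h3 : ((u * v) ^ m)⁻¹ ≤ ((α * α) ^ m)⁻¹ := by
    rw [mul_pow, mul_inv, h1, h2, mul_pow, mul_inv]
    nlinarith [sq_nonneg q]
  have h4 : α * α ≤ u * v :=
    le_of_pow_le_pow_left₀ hm (by positivity) ((inv_le_inv₀ (by positivity) (by positivity)).1 h3)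
  have h5 := pow_le_pow_left₀ (by positivity) h4 (m + 1)
  calc 2 * α ^ (2 * m + 2) = 2 * (α * α) ^ (m + 1) := by ring
    _ ≤ 2 * (u * v) ^ (m + 1) := by linarith
    _ ≤ _ := by
      have := two_mul_le_add_sq (u ^ (m + 1)) (v ^ (m + 1))
      calc _ = 2 * u ^ (m + 1) * v ^ (m + 1) := by ring
        _ ≤ _ := this
        _ = _ := by ring

lemma pow_add_two_eq_of_inv_pow {m : ℕ} (hm : m ≠ 0) {α u q : ℝ} (hα : 0 < α) (hu : 0 < u)
    (h : (u ^ m)⁻¹ = (α ^ m)⁻¹ - q) :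
    u ^ (m + 2) = α ^ (m + 2) * (1 - α ^ m * q) ^ (-((m + 2 : ℝ) / m)) := by
  have hm' : (m : ℝ) ≠ 0 := Nat.cast_ne_zero.2 hm
  have h1 : 1 - α ^ m * q = (α / u) ^ (m : ℝ) := by
    rw [rpow_natCast, div_pow, div_eq_mul_inv, h]
    field_simp
  rw [h1, ← rpow_mul (by positivity), mul_neg, mul_div_cancel₀ _ hm', rpow_neg (by positivity),
    show (m + 2 : ℝ) = ((m + 2 : ℕ) : ℝ) by push_cast; rfl, rpow_natCast, div_pow, inv_div]
  field_simp

lemma margin_sq_mul_le {ι κ : Type*} [Fintype ι] [Fintype κ] {r : κ → ℝ} {x : κ → ι → ℝ}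
    {g : ℝ} {v : ι → ℝ} (hg : 0 ≤ g) (hr : ∀ n, 0 ≤ r n) (hv : ∑ i, v i ^ 2 = 1)
    (hgv : ∀ n, g ≤ ∑ i, x n i * v i) :
    g ^ 2 * (∑ n, r n) ^ 2 ≤ ∑ i, (∑ n, r n * x n i) ^ 2 := by
  have h1 : g * ∑ n, r n ≤ ∑ i, (∑ n, r n * x n i) * v i := by
    calc g * ∑ n, r n = ∑ n, r n * g := by rw [mul_sum]; exact sum_congr rfl fun _ _ => mul_comm _ _
      _ ≤ ∑ n, r n * ∑ i, x n i * v i :=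
        sum_le_sum fun n _ => mul_le_mul_of_nonneg_left (hgv n) (hr n)
      _ = _ := by
        simp_rw [mul_sum, sum_mul]
        rw [sum_comm]
        exact sum_congr rfl fun i _ => sum_congr rfl fun n _ => by ring
  have h2 := sum_mul_sq_le_sq_mul_sq univ (fun i => ∑ n, r n * x n i) v
  rw [hv, mul_one] at h2
  rw [← mul_pow]
  exact (pow_le_pow_left₀ (mul_nonneg hg (sum_nonneg fun n _ => hr n)) h1 2).trans h2

theorem stmt19
    (d N D : ℕ) (hd : 0 < d) (hN : 0 < N) (hD : 2 < D)
    (x : Fin N → Fin d → ℝ)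
    (γ₂ : ℝ) (hγ₂pos : 0 < γ₂)
    (hγ₂ : IsGreatest {g : ℝ | ∃ v : Fin d → ℝ, (∑ i, (v i)^2) = 1 ∧ ∀ n, g ≤ ∑ i, x n i * v i} γ₂)
    (α : ℝ) (hα : 0 < α)
    (up um : ℝ → Fin d → ℝ)
    (hinit : ∀ i, up 0 i = α ∧ um 0 i = α)
    (w : ℝ → Fin d → ℝ)
    (hw : ∀ t i, w t i = (up t i)^D - (um t i)^D)
    (hflowp : ∀ t, 0 ≤ t → ∀ i, HasDerivAt (fun s => up s i)
        (((D:ℝ)/(N:ℝ)) * (up t i)^(D-1) * ∑ n, Real.exp (-(∑ j, x n j * w t j)) * x n i) t)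
    (hflowm : ∀ t, 0 ≤ t → ∀ i, HasDerivAt (fun s => um s i)
        (-(((D:ℝ)/(N:ℝ)) * (um t i)^(D-1) * ∑ n, Real.exp (-(∑ j, x n j * w t j)) * x n i)) t)
    (Lf : ℝ → ℝ)
    (hLf : ∀ t, Lf t = (1 / (N:ℝ)) * ∑ n, Real.exp (-(∑ i, x n i * w t i)))
    (r : ℝ → Fin N → ℝ)
    (hr : ∀ t n, r t n = (1 / (N:ℝ)) * Real.exp (-(∑ i, x n i * w t i)))
    (xbar : ℝ)
    (hxbar : IsGreatest {v : ℝ | ∃ i : Fin d, v = ∑ n, |x n i|} xbar)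
    (xmax : ℝ)
    (hxmax : IsGreatest {v : ℝ | ∃ n : Fin N, v = Real.sqrt (∑ i, (x n i)^2)} xmax)
    :
    ∀ t : ℝ, 0 ≤ t →
      ((D:ℝ)-2) * xbar * (-Real.log (Lf t)) < 2 * (D:ℝ) * γ₂^2 * α^D →
      ∀ z : ℝ,
      z = (((D:ℝ)-2) * xbar / (2 * (D:ℝ) * γ₂^2 * α^D)) * (-Real.log (Lf t)) →
      Real.sqrt (∑ i, (w t i)^2) ≤
        (xmax / (2 * γ₂^2)) * ((2 * γ₂^2 * α^D / xbar) *
            ((1 - z) ^ (-(D:ℝ)/((D:ℝ)-2)) - (1 + z) ^ (-(D:ℝ)/((D:ℝ)-2))) - 2 * (-Real.log (Lf t)))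
        + 2 * (D:ℝ)^2 * α^(2*D-2) * ∫ τ in (0:ℝ)..t, Real.sqrt (∑ i, (∑ n, r τ n * x n i)^2) := by
  intro t ht hzlt z hz
  obtain ⟨m, rfl⟩ : ∃ m, D = m + 2 := ⟨D - 2, by omega⟩
  have hm : m ≠ 0 := by omega
  have hm0 : (0:ℝ) < m := by positivity
  have hN0 : (0:ℝ) < N := by positivity
  have hcast : ((m + 2 : ℕ) : ℝ) = m + 2 := by push_cast; rfl
  rw [hcast] at hzlt hz hflowp hflowm ⊢
  rw [show (m : ℝ) + 2 - 2 = m by ring] at hzlt hz ⊢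
  rw [show 2 * (m + 2) - 2 = 2 * m + 2 by omega, neg_div]
  simp only [show m + 2 - 1 = m + 1 by omega] at hflowp hflowm
  obtain ⟨⟨v, hv, hgv⟩, -⟩ := hγ₂
  -- residuals
  have hrpos : ∀ s n, 0 ≤ r s n := fun s n => by rw [hr]; positivity
  have hLr : ∀ s, Lf s = ∑ n, r s n := fun s => by simp only [hLf, hr, mul_sum]
  have hLpos : ∀ s, 0 < Lf s := fun s => by
    have : Nonempty (Fin N) := ⟨⟨0, hN⟩⟩
    rw [hLf]
    exact mul_pos (by positivity) (sum_pos (fun n _ => exp_pos _) univ_nonempty)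
  set a : Fin d → ℝ → ℝ := fun i s => ∑ n, r s n * x n i with ha
  have hup : ∀ i s, 0 ≤ s →
      HasDerivAt (fun s => up s i) ((m + 2) * up s i ^ (m + 1) * a i s) s := fun i s hs => by
    refine (hflowp s hs i).congr_deriv ?_
    simp only [ha, hr, mul_sum]
    exact sum_congr rfl fun n _ => by ring
  have hum : ∀ i s, 0 ≤ s →
      HasDerivAt (fun s => um s i) ((m + 2) * um s i ^ (m + 1) * -a i s) s := fun i s hs => by
    refine (hflowm s hs i).congr_deriv ?_
    simp only [ha, hr, mul_sum, ← sum_neg_distrib]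
    exact sum_congr rfl fun n _ => by ring
  have hwd : ∀ i s, 0 ≤ s → HasDerivAt (fun s => w s i)
      ((m + 2) ^ 2 * (up s i ^ (2 * m + 2) + um s i ^ (2 * m + 2)) * a i s) s := fun i s hs => by
    simp only [hw]
    refine (((hup i s hs).pow (m + 2)).sub ((hum i s hs).pow (m + 2))).congr_deriv ?_
    simp only [show m + 2 - 1 = m + 1 by omega]
    push_cast
    ring
  have hrd : ∀ n s, 0 ≤ s → HasDerivAt (fun s => r s n) (-(r s n * ∑ i, x n i *
      ((m + 2) ^ 2 * (up s i ^ (2 * m + 2) + um s i ^ (2 * m + 2)) * a i s))) s := fun n s hs => by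
    simp only [hr]
    refine ((HasDerivAt.fun_sum fun i _ =>
      (hwd i s hs).const_mul (x n i)).fun_neg.exp.const_mul (1 / (N:ℝ))).congr_deriv ?_
    ring
  have hLd : ∀ s, 0 ≤ s → HasDerivAt Lf (-∑ i, a i s *
      ((m + 2) ^ 2 * (up s i ^ (2 * m + 2) + um s i ^ (2 * m + 2)) * a i s)) s := fun s hs => by
    rw [show Lf = fun s => ∑ n, r s n from funext hLr]
    refine (HasDerivAt.fun_sum fun n _ => hrd n s hs).congr_deriv ?_
    rw [sum_neg_distrib]
    congr 1
    simp_rw [mul_sum]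
    rw [sum_comm]
    refine sum_congr rfl fun i _ => ?_
    conv_rhs => rw [show a i s = ∑ n, r s n * x n i from rfl, sum_mul]
    exact sum_congr rfl fun n _ => by ring
  have hca : ∀ i, ContinuousOn (a i) (Set.Ici 0) := fun i =>
    continuousOn_finsetSum _ fun n _ => ContinuousOn.mul
      (fun s hs => (hrd n s hs).continuousAt.continuousWithinAt) continuousOn_const
  choose G hGint hG using fun i => exists_primitive_Ici (hca i)
  have hG0 : ∀ i, G i 0 = 0 := fun i => by simp [hGint i 0 le_rfl]
  obtain ⟨F, hFint, hF⟩ := exists_primitive_Ici (f := Lf)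
    fun s hs => (hLd s hs).continuousAt.continuousWithinAt
  have hF0 : F 0 = 0 := by simp [hFint 0 le_rfl]
  obtain ⟨H, hHint, hH⟩ := exists_primitive_Ici (f := fun s => √(∑ i, a i s ^ 2))
    (continuousOn_finsetSum _ fun i _ => (hca i).pow 2).sqrt
  have hH0 : H 0 = 0 := by simp [hHint 0 le_rfl]
  -- explicit solution
  have hsolp : ∀ i s, 0 ≤ s → 0 < up s i ∧
      (up s i ^ m)⁻¹ = (α ^ m)⁻¹ - (m + 2) * m * G i s := fun i s hs => by
    have := pos_and_inv_pow_of_hasDerivAt (hca i) (hG i) (hG0 i) (hup i)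
      (by rw [(hinit i).1]; exact hα) hs
    rwa [(hinit i).1] at this
  have hsolm : ∀ i s, 0 ≤ s → 0 < um s i ∧
      (um s i ^ m)⁻¹ = (α ^ m)⁻¹ + (m + 2) * m * G i s := fun i s hs => by
    have := pos_and_inv_pow_of_hasDerivAt (hca i).neg (A := fun s => -G i s)
      (fun s hs => (hG i s hs).fun_neg) (by simp [hG0]) (hum i)
      (by rw [(hinit i).2]; exact hα) hs
    rw [(hinit i).2] at this
    refine ⟨this.1, this.2.trans (by ring)⟩
  -- lower bound on the decrease of the loss
  have hdecay : ∀ s, 0 ≤ s → 2 * (m + 2) ^ 2 * α ^ (2 * m + 2) * γ₂ ^ 2 * Lf s ≤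
      (∑ i, a i s * ((m + 2) ^ 2 * (up s i ^ (2 * m + 2) + um s i ^ (2 * m + 2)) * a i s)) / Lf s :=
    fun s hs => by
      rw [le_div_iff₀ (hLpos s)]
      calc _ = (m + 2) ^ 2 * (2 * α ^ (2 * m + 2)) * (γ₂ ^ 2 * (∑ n, r s n) ^ 2) := by
            rw [hLr]; ring
        _ ≤ (m + 2) ^ 2 * (2 * α ^ (2 * m + 2)) * ∑ i, a i s ^ 2 :=
          mul_le_mul_of_nonneg_left (margin_sq_mul_le hγ₂pos.le (hrpos s) hv hgv) (by positivity)
        _ ≤ _ := by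
          rw [mul_sum]
          refine sum_le_sum fun i _ => ?_
          have h := two_mul_pow_le_of_inv_pow hm hα (hsolp i s hs).1 (hsolm i s hs).1
            (hsolp i s hs).2 (hsolm i s hs).2
          calc _ = (m + 2) ^ 2 * a i s ^ 2 * (2 * α ^ (2 * m + 2)) := by ring
            _ ≤ (m + 2) ^ 2 * a i s ^ 2 * (up s i ^ (2 * m + 2) + um s i ^ (2 * m + 2)) :=
              mul_le_mul_of_nonneg_left h (by positivity)
            _ = _ := by ring
  have hL0 : Lf 0 = 1 := by
    have hw0 : ∀ i, w 0 i = 0 := fun i => by rw [hw, (hinit i).1, (hinit i).2, sub_self]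
    simp only [hLf, hw0, mul_zero, sum_const_zero, neg_zero, exp_zero, sum_const, card_univ,
      Fintype.card_fin, nsmul_eq_mul, mul_one]
    field_simp
  have hFlog : 2 * (m + 2) ^ 2 * α ^ (2 * m + 2) * γ₂ ^ 2 * F t ≤ -log (Lf t) := by
    have := apply_zero_le_of_hasDerivAt_nonneg
      (fun s hs => (((hLd s hs).log (hLpos s).ne').fun_neg.fun_sub
        ((hF s hs).const_mul (2 * (m + 2) ^ 2 * α ^ (2 * m + 2) * γ₂ ^ 2 : ℝ))))
      (fun s hs => by
        have := hdecay s hs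
        rw [neg_div, neg_neg]
        linarith) ht
    simp only [hL0, hF0, log_one, neg_zero, mul_zero, sub_zero] at this
    linarith
  -- bounds on the primitives
  have hxb : ∀ i, ∑ n, |x n i| ≤ xbar := fun i => hxbar.2 ⟨i, rfl⟩
  have hxbar0 : 0 ≤ xbar := (sum_nonneg fun n _ => abs_nonneg _).trans (hxb ⟨0, hd⟩)
  have hxbarpos : 0 < xbar := by
    refine hxbar0.lt_of_ne fun h0 => ?_
    have hx0 : ∀ n i, x n i = 0 := fun n i => by
      have h1 := single_le_sum (f := fun n => |x n i|) (fun n _ => abs_nonneg _) (mem_univ n)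
      exact abs_nonpos_iff.1 (h1.trans ((hxb i).trans h0.ge))
    have := hgv ⟨0, hN⟩
    simp only [hx0, zero_mul, sum_const_zero] at this
    linarith
  have hxm : ∀ n, √(∑ i, x n i ^ 2) ≤ xmax := fun n => hxmax.2 ⟨n, rfl⟩
  have hxmax0 : 0 ≤ xmax := (sqrt_nonneg _).trans (hxm ⟨0, hN⟩)
  have hGabs : ∀ i, |G i t| ≤ xbar * F t := fun i => by
    have ha_le : ∀ s, |a i s| ≤ xbar * Lf s := fun s => by
      calc |a i s| ≤ ∑ n, |r s n * x n i| := abs_sum_le_sum_abs _ _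
        _ ≤ ∑ n, Lf s * |x n i| := by
          refine sum_le_sum fun n _ => ?_
          rw [abs_mul, abs_of_nonneg (hrpos s n)]
          refine mul_le_mul_of_nonneg_right ?_ (abs_nonneg _)
          rw [hLr]
          exact single_le_sum (fun n _ => hrpos s n) (mem_univ n)
        _ ≤ _ := by
          rw [← mul_sum, mul_comm]
          exact mul_le_mul_of_nonneg_right (hxb i) (hLpos s).le
    have h1 := apply_zero_le_of_hasDerivAt_nonneg
      (fun s hs => ((hF s hs).const_mul xbar).fun_sub (hG i s hs))
      (fun s _ => by linarith [(abs_le.1 (ha_le s)).2]) ht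
    have h2 := apply_zero_le_of_hasDerivAt_nonneg
      (fun s hs => ((hF s hs).const_mul xbar).fun_add (hG i s hs))
      (fun s _ => by linarith [(abs_le.1 (ha_le s)).1]) ht
    simp only [hF0, hG0, mul_zero, sub_zero, add_zero] at h1 h2
    exact abs_le.2 ⟨by linarith, by linarith⟩
  have hGH : √(∑ i, G i t ^ 2) ≤ H t :=
    sqrt_sum_sq_le_of_hasDerivAt hG hG0 hH hH0 (fun _ _ => le_rfl) ht
  have hGF : √(∑ i, G i t ^ 2) ≤ xmax * F t :=
    sqrt_sum_sq_le_of_hasDerivAt hG hG0 (F := fun s => xmax * F s)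
      (fun s hs => (hF s hs).const_mul xmax) (by simp [hF0])
      (fun s _ => by
        have := sqrt_sum_sq_sum_mul_le (hrpos s) hxm
        rwa [← hLr] at this) ht
  -- the rescaled time
  set c : ℝ := (m + 2) * m * α ^ m with hc
  have hc0 : 0 < c := by positivity
  have hz1 : z < 1 := by
    rw [hz, div_mul_eq_mul_div, div_lt_one (by positivity)]
    exact hzlt
  have hcF : c * xbar * F t ≤ z := by
    calc c * xbar * F t = (m * xbar / (2 * (m + 2) * γ₂ ^ 2 * α ^ (m + 2))) *
          (2 * (m + 2) ^ 2 * α ^ (2 * m + 2) * γ₂ ^ 2 * F t) := by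
          rw [hc]
          field_simp
          ring
      _ ≤ _ := by
          rw [hz]
          exact mul_le_mul_of_nonneg_left hFlog (by positivity)
  have hsz : ∀ i, |c * G i t| ≤ z := fun i => by
    rw [abs_mul, abs_of_pos hc0]
    calc c * |G i t| ≤ c * (xbar * F t) := mul_le_mul_of_nonneg_left (hGabs i) hc0.le
      _ ≤ z := by linarith
  have hz0 : 0 ≤ z := (abs_nonneg _).trans (hsz ⟨0, hd⟩)
  set p : ℝ := (m + 2) / m with hp
  have hp0 : 0 < p := by positivity
  set M : ℝ := superlinearPart p z / z with hM
  have hM0 : 0 ≤ M :=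
    div_nonneg ((superlinearPart_nonneg_convexOn hp0).1 z ⟨hz0, hz1⟩) hz0
  have hMz : M * z = superlinearPart p z := by
    rcases hz0.eq_or_lt with h | h
    · rw [← h, mul_zero, superlinearPart_zero]
    · exact div_mul_cancel₀ _ h.ne'
  have hweq : ∀ i, w t i = 2 * (m + 2) ^ 2 * α ^ (2 * m + 2) * G i t +
      α ^ (m + 2) * superlinearPart p (c * G i t) := fun i => by
    rw [hw, pow_add_two_eq_of_inv_pow hm hα (hsolp i t ht).1 (hsolp i t ht).2,
      pow_add_two_eq_of_inv_pow hm hα (hsolm i t ht).1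
        ((hsolm i t ht).2.trans (sub_neg_eq_add _ _).symm), superlinearPart, ← hp,
      show 1 - α ^ m * ((m + 2) * m * G i t) = 1 - c * G i t by rw [hc]; ring,
      show 1 - α ^ m * -((m + 2) * m * G i t) = 1 + c * G i t by rw [hc]; ring]
    have : p * m = m + 2 := div_mul_cancel₀ _ hm0.ne'
    rw [hc]
    linear_combination (2 * α ^ (2 * m + 2) * (m + 2) * G i t) * this
  set B : ℝ := 2 * (m + 2) ^ 2 * α ^ (2 * m + 2) + α ^ (m + 2) * (M * c) with hB
  have hB0 : 0 ≤ B := by positivity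
  have hwabs : ∀ i, |w t i| ≤ B * |G i t| := fun i => by
    have h1 := abs_superlinearPart_le hp0 (hsz i) hz1
    rw [abs_mul, abs_of_pos hc0, ← hM] at h1
    rw [hweq]
    refine (abs_add_le _ _).trans ?_
    rw [abs_mul, abs_mul (α ^ (m + 2)), abs_of_nonneg (by positivity : 0 ≤ α ^ (m + 2)),
      abs_of_nonneg (by positivity : (0:ℝ) ≤ 2 * (m + 2) ^ 2 * α ^ (2 * m + 2)), hB, add_mul]
    have := mul_le_mul_of_nonneg_left h1 (by positivity : 0 ≤ α ^ (m + 2))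
    linarith
  have hwB : √(∑ i, w t i ^ 2) ≤ B * √(∑ i, G i t ^ 2) := by
    rw [← sqrt_sq hB0, ← sqrt_mul (sq_nonneg B), mul_sum]
    refine sqrt_le_sqrt (sum_le_sum fun i _ => ?_)
    rw [← sq_abs (w t i), ← sq_abs (G i t), ← mul_pow]
    exact pow_le_pow_left₀ (abs_nonneg _) (hwabs i) 2
  have hH_le : 2 * (m + 2) ^ 2 * α ^ (2 * m + 2) * √(∑ i, G i t ^ 2) ≤
      2 * (m + 2) ^ 2 * α ^ (2 * m + 2) * H t := mul_le_mul_of_nonneg_left hGH (by positivity)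
  have hk : α ^ (m + 2) * (M * c) * √(∑ i, G i t ^ 2) ≤
      xmax / xbar * (α ^ (m + 2) * superlinearPart p z) := by
    calc _ ≤ α ^ (m + 2) * (M * c) * (xmax * F t) :=
          mul_le_mul_of_nonneg_left hGF (by positivity)
      _ = xmax / xbar * α ^ (m + 2) * M * (c * xbar * F t) := by field_simp
      _ ≤ xmax / xbar * α ^ (m + 2) * M * z := mul_le_mul_of_nonneg_left hcF (by positivity)
      _ = _ := by rw [← hMz]; ring
  have hrhs : xmax / (2 * γ₂ ^ 2) * (2 * γ₂ ^ 2 * α ^ (m + 2) / xbar *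
      ((1 - z) ^ (-p) - (1 + z) ^ (-p)) - 2 * -log (Lf t)) =
      xmax / xbar * (α ^ (m + 2) * superlinearPart p z) := by
    have h1 : α ^ (m + 2) * (2 * p * z) = xbar / γ₂ ^ 2 * -log (Lf t) := by
      rw [hz, hp]
      field_simp
    rw [superlinearPart, mul_sub (α ^ (m + 2)), h1]
    field_simp
  rw [hrhs, ← hHint t ht]
  rw [hB, add_mul] at hwB
  linarith
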